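/- Let n, m be positive integers, let σ = co{x₀,…,xₙ} ⊂ ℝⁿ be an n-simplex, and let ζ : ℝⁿ → ℝ^m be twice continuously differentiable on a neighborhood of σ. For k = 1,…,m let μ_k ≥ 0 satisfy μ_k ≥ |∂²ζ⁽ᵏ⁾(x)/∂x⁽q⁾∂x⁽r⁾ evaluated at ξ| for all q, r ∈ {1,…,n} and ξ ∈ σ, and for j = 0,…,n define cⱼ = max_{ν∈{0,…,n}} ‖xⱼ − x_ν‖₂². Then for every x ∈ σ with barycentric coordinates λ₀,…,λₙ (λⱼ ≥ 0, Σⱼλⱼ = 1, x = Σⱼλⱼxⱼ), one has ‖ζ(x) − Σ_{j=0}^n λⱼ ζ(xⱼ)‖₂ ≤ ½ n (Σ_{k=1}^m μ_k) (Σ_{j=0}^n λⱼ cⱼ). -/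

import Mathlib

open Matrix

/-- The Euclidean (2-)norm of a finitely indexed real vector. -/
noncomputable def norm2 {ι : Type*} [Fintype ι] (v : ι → ℝ) : ℝ :=
  Real.sqrt (∑ i, v i ^ 2)

/-- First-order Taylor estimate on the unit interval under a bound on the second derivative. -/
lemma abs_sub_sub_le_half_of_second_deriv_bound {g g₁ g₂ : ℝ → ℝ} {K : ℝ}
    (hg : ∀ t ∈ Set.Icc (0 : ℝ) 1, HasDerivAt g (g₁ t) t)
    (hg₁ : ∀ t ∈ Set.Icc (0 : ℝ) 1, HasDerivAt g₁ (g₂ t) t)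
    (hK : ∀ t ∈ Set.Icc (0 : ℝ) 1, |g₂ t| ≤ K) :
    |g 1 - g 0 - g₁ 0| ≤ K / 2 := by
  have hfirst : ∀ t ∈ Set.Icc (0 : ℝ) 1, ‖g₁ t - g₁ 0‖ ≤ K * (t - 0) :=
    norm_image_sub_le_of_norm_deriv_le_segment'
      (fun t ht => (hg₁ t ht).hasDerivWithinAt)
      (fun t ht => hK t (Set.Ico_subset_Icc_self ht))
  have hderiv : ∀ t ∈ Set.Icc (0 : ℝ) 1,
      HasDerivAt (fun s => g s - g 0 - s * g₁ 0) (g₁ t - g₁ 0) t := by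
    intro t ht
    have h := ((hg t ht).sub_const (g 0)).sub ((hasDerivAt_id t).mul_const (g₁ 0))
    rwa [one_mul] at h
  have hquad : ∀ t : ℝ, HasDerivAt (fun s => K / 2 * s ^ 2) (K * (t - 0)) t := by
    intro t
    refine ((hasDerivAt_pow 2 t).const_mul (K / 2)).congr_deriv ?_
    norm_num
    ring
  have h := image_norm_le_of_norm_deriv_right_le_deriv_boundary
    (f := fun s => g s - g 0 - s * g₁ 0)
    (fun t ht => (hderiv t ht).continuousAt.continuousWithinAt)
    (fun t ht => (hderiv t (Set.Ico_subset_Icc_self ht)).hasDerivWithinAt)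
    (by simp) hquad
    (fun t ht => hfirst t (Set.Ico_subset_Icc_self ht))
    (Set.right_mem_Icc.2 zero_le_one)
  simpa using h

lemma norm2_sq {ι : Type*} [Fintype ι] (v : ι → ℝ) : norm2 v ^ 2 = ∑ i, v i ^ 2 :=
  Real.sq_sqrt (Finset.sum_nonneg fun _ _ => sq_nonneg _)

lemma norm2_le_sum_abs {ι : Type*} [Fintype ι] (v : ι → ℝ) : norm2 v ≤ ∑ i, |v i| := by
  refine Real.sqrt_le_iff.2 ⟨Finset.sum_nonneg fun _ _ => abs_nonneg _, ?_⟩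
  simpa using Finset.sum_sq_le_sq_sum_of_nonneg (s := Finset.univ) (f := fun i => |v i|)
    fun _ _ => abs_nonneg _

lemma convexOn_norm2_sub_sq {ι : Type*} [Fintype ι] (p : ι → ℝ) :
    ConvexOn ℝ Set.univ (fun y : ι → ℝ => norm2 (p - y) ^ 2) := by
  refine ⟨convex_univ, fun y _ z _ a b ha hb hab => ?_⟩
  simp only [norm2_sq, smul_eq_mul, Finset.mul_sum, ← Finset.sum_add_distrib]
  refine Finset.sum_le_sum fun i _ => ?_
  obtain rfl : b = 1 - a := by linarith
  simp only [Pi.sub_apply, Pi.add_apply, Pi.smul_apply, smul_eq_mul]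
  nlinarith [mul_nonneg (mul_nonneg ha hb) (sq_nonneg (y i - z i))]

/-- A bilinear form with entries bounded by `M` is bounded by `n * M` on the diagonal. -/
lemma abs_bilin_diag_le {n : ℕ} (B : (Fin n → ℝ) →L[ℝ] (Fin n → ℝ) →L[ℝ] ℝ) {M : ℝ}
    (hM : 0 ≤ M) (hB : ∀ q r, |B (Pi.single r 1) (Pi.single q 1)| ≤ M) (d : Fin n → ℝ) :
    |B d d| ≤ n * M * norm2 d ^ 2 := by
  have hd : d = ∑ i, d i • (Pi.single i 1 : Fin n → ℝ) := pi_eq_sum_univ' d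
  have hexp : B d d = ∑ r, ∑ q, d r * (d q * B (Pi.single r 1) (Pi.single q 1)) := by
    conv_lhs => rw [hd]
    simp only [map_sum, map_smul, _root_.sum_apply, _root_.smul_apply,
      smul_eq_mul, Finset.mul_sum]
    rw [Finset.sum_comm]
    refine Finset.sum_congr rfl fun r _ => Finset.sum_congr rfl fun q _ => by ring
  calc |B d d| ≤ ∑ r, ∑ q, |d r| * (|d q| * M) := by
        rw [hexp]
        refine (Finset.abs_sum_le_sum_abs _ _).trans (Finset.sum_le_sum fun r _ => ?_)
        refine (Finset.abs_sum_le_sum_abs _ _).trans (Finset.sum_le_sum fun q _ => ?_)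
        rw [abs_mul, abs_mul]
        gcongr
        exact hB q r
    _ = M * (∑ i, |d i|) ^ 2 := by
        simp_rw [sq, Finset.sum_mul_sum, Finset.mul_sum]
        refine Finset.sum_congr rfl fun r _ => Finset.sum_congr rfl fun q _ => by ring
    _ ≤ M * (n * ∑ i, |d i| ^ 2) := by
        gcongr
        simpa using sq_sum_le_card_mul_sum_sq (s := Finset.univ) (f := fun i => |d i|)
    _ = n * M * norm2 d ^ 2 := by
        simp only [norm2_sq, sq_abs]
        ring

/-- First-order Taylor estimate on a convex set from bounds on second partial derivatives. -/
lemma abs_taylor_remainder_le {n : ℕ} {f : (Fin n → ℝ) → ℝ} {U S : Set (Fin n → ℝ)}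
    (hU : IsOpen U) (hS : Convex ℝ S) (hSU : S ⊆ U) (hf : ContDiffOn ℝ 2 f U) {M : ℝ}
    (hM : 0 ≤ M)
    (hbound : ∀ (q r : Fin n), ∀ ξ ∈ S,
      |fderiv ℝ (fun y => fderiv ℝ f y (Pi.single q 1)) ξ (Pi.single r 1)| ≤ M)
    {x p : Fin n → ℝ} (hx : x ∈ S) (hp : p ∈ S) :
    |f p - f x - fderiv ℝ f x (p - x)| ≤ n * M * norm2 (p - x) ^ 2 / 2 := by
  have hmem : ∀ t ∈ Set.Icc (0 : ℝ) 1, x + t • (p - x) ∈ S :=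
    fun t ht => hS.add_smul_sub_mem hx hp ht
  have hdiff : ∀ ξ ∈ U, DifferentiableAt ℝ f ξ := fun ξ hξ =>
    (hf.differentiableOn (by norm_num)).differentiableAt (hU.mem_nhds hξ)
  have hdiff' : ∀ ξ ∈ U, DifferentiableAt ℝ (fderiv ℝ f) ξ := fun ξ hξ =>
    ((hf.fderiv_of_isOpen (m := 1) hU (by norm_num)).differentiableOn
      (by norm_num)).differentiableAt (hU.mem_nhds hξ)
  have hline : ∀ t : ℝ, HasDerivAt (fun s : ℝ => x + s • (p - x)) (p - x) t := by
    intro t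
    simpa using ((hasDerivAt_id t).smul_const (p - x)).const_add x
  have h := abs_sub_sub_le_half_of_second_deriv_bound
    (g := fun t => f (x + t • (p - x)))
    (g₁ := fun t => fderiv ℝ f (x + t • (p - x)) (p - x))
    (g₂ := fun t => fderiv ℝ (fderiv ℝ f) (x + t • (p - x)) (p - x) (p - x))
    (K := n * M * norm2 (p - x) ^ 2)
    (fun t ht => (hdiff _ (hSU (hmem t ht))).hasFDerivAt.comp_hasDerivAt t (hline t))
    (fun t ht => by
      have h := (hdiff' _ (hSU (hmem t ht))).hasFDerivAt.comp_hasDerivAt t (hline t)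
      simpa using h.clm_apply (hasDerivAt_const t (p - x)))
    (fun t ht => by
      refine abs_bilin_diag_le _ hM (fun q r => ?_) _
      have h := hbound q r _ (hmem t ht)
      rw [fderiv_clm_apply (hdiff' _ (hSU (hmem t ht))) (differentiableAt_const _)] at h
      simpa using h)
  simpa using h

/-- the 2-norm bound of Lemma 5, Appendix A of the paper: for a `C²`
map `ζ : ℝⁿ → ℝ^m` on a neighborhood of the simplex with second partial derivative
bounds `μₖ` and `cⱼ = max_ν ‖xⱼ − x_ν‖₂²`, for every `x` in the simplex with
barycentric coordinates `λ`:
`‖ζ(x) − Σⱼ λⱼ ζ(xⱼ)‖₂ ≤ ½ n (Σₖ μₖ)(Σⱼ λⱼ cⱼ)`. -/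
theorem interpolation_error_two_norm {n m : ℕ} (hn : 0 < n) (hm : 0 < m)
    (pts : Fin (n + 1) → (Fin n → ℝ))
    (hind : LinearIndependent ℝ (fun j : Fin n => pts j.succ - pts 0))
    (ζ : (Fin n → ℝ) → (Fin m → ℝ))
    (U : Set (Fin n → ℝ)) (hU : IsOpen U)
    (hσU : convexHull ℝ (Set.range pts) ⊆ U)
    (hζ : ContDiffOn ℝ 2 ζ U)
    (μ : Fin m → ℝ) (hμ0 : ∀ k, 0 ≤ μ k)
    (hμ : ∀ (k : Fin m) (q r : Fin n), ∀ ξ ∈ convexHull ℝ (Set.range pts),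
      |fderiv ℝ (fun y => fderiv ℝ (fun w => ζ w k) y (Pi.single q 1)) ξ
        (Pi.single r 1)| ≤ μ k)
    (lam : Fin (n + 1) → ℝ)
    (hlam0 : ∀ j, 0 ≤ lam j) (hlam1 : ∑ j, lam j = 1)
    (x : Fin n → ℝ) (hx : x = ∑ j, lam j • pts j) :
    norm2 (ζ x - ∑ j, lam j • ζ (pts j)) ≤
      (1 / 2) * n * (∑ k, μ k) *
        (∑ j, lam j *
          Finset.univ.sup' Finset.univ_nonempty
            (fun ν : Fin (n + 1) => norm2 (pts j - pts ν) ^ 2)) := by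
  have hxS : x ∈ convexHull ℝ (Set.range pts) := by
    rw [hx]
    exact (convex_convexHull ℝ _).sum_mem (fun j _ => hlam0 j) hlam1
      fun j _ => subset_convexHull ℝ _ (Set.mem_range_self j)
  have hdist : ∀ j, norm2 (pts j - x) ^ 2 ≤ Finset.univ.sup' Finset.univ_nonempty
      (fun ν : Fin (n + 1) => norm2 (pts j - pts ν) ^ 2) := by
    intro j
    obtain ⟨_, ⟨ν, rfl⟩, hν⟩ := ((convexOn_norm2_sub_sq (pts j)).subset
      (Set.subset_univ _) (convex_convexHull ℝ (Set.range pts))).exists_ge_of_mem_convexHull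
      (subset_convexHull ℝ _) hxS
    exact hν.trans (Finset.le_sup' (fun ν => norm2 (pts j - pts ν) ^ 2) (Finset.mem_univ ν))
  set c : Fin (n + 1) → ℝ := fun j => Finset.univ.sup' Finset.univ_nonempty
      (fun ν : Fin (n + 1) => norm2 (pts j - pts ν) ^ 2)
  have hcomp : ∀ k, |(ζ x - ∑ j, lam j • ζ (pts j)) k| ≤
      (1 / 2) * n * μ k * ∑ j, lam j * c j := by
    intro k
    set L := fderiv ℝ (fun w => ζ w k) x
    have hlin : ∑ j, lam j * L (pts j - x) = 0 := by
      have h : ∑ j, lam j • (pts j - x) = 0 := by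
        simp only [smul_sub, Finset.sum_sub_distrib, ← Finset.sum_smul, hlam1, one_smul, ← hx,
          sub_self]
      simpa only [map_sum, map_smul, smul_eq_mul, map_zero] using congrArg L h
    have hrem : (ζ x - ∑ j, lam j • ζ (pts j)) k =
        -∑ j, lam j * (ζ (pts j) k - ζ x k - L (pts j - x)) := by
      simp only [mul_sub, Finset.sum_sub_distrib, ← Finset.sum_mul, hlam1]
      simp only [hlin, Pi.sub_apply, Finset.sum_apply, Pi.smul_apply, smul_eq_mul]
      ring
    rw [hrem, abs_neg, Finset.mul_sum]
    refine (Finset.abs_sum_le_sum_abs _ _).trans (Finset.sum_le_sum fun j _ => ?_)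
    rw [abs_mul, abs_of_nonneg (hlam0 j)]
    have hT := abs_taylor_remainder_le hU (convex_convexHull ℝ _) hσU
      (contDiffOn_pi.1 hζ k) (hμ0 k) (hμ k) hxS
      (subset_convexHull ℝ _ (Set.mem_range_self j))
    have hnμ : 0 ≤ n * μ k := mul_nonneg n.cast_nonneg (hμ0 k)
    calc lam j * |ζ (pts j) k - ζ x k - L (pts j - x)|
        ≤ lam j * (n * μ k * c j / 2) := by
          refine mul_le_mul_of_nonneg_left (hT.trans ?_) (hlam0 j)
          linarith [mul_le_mul_of_nonneg_left (hdist j) hnμ]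
      _ = 1 / 2 * n * μ k * (lam j * c j) := by ring
  calc norm2 (ζ x - ∑ j, lam j • ζ (pts j))
      ≤ ∑ k, |(ζ x - ∑ j, lam j • ζ (pts j)) k| := norm2_le_sum_abs _
    _ ≤ ∑ k, (1 / 2) * n * μ k * ∑ j, lam j * c j := Finset.sum_le_sum fun k _ => hcomp k
    _ = (1 / 2) * n * (∑ k, μ k) * ∑ j, lam j * c j := by
        rw [← Finset.sum_mul, ← Finset.mul_sum]
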